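/- Let p be a probability distribution on ℤ supported on {0,1,…,M−1} and let q be a probability distribution on ℤ supported on {0,1,…,N−1}, for positive integers M, N. Define q̃ on ℤ by q̃(i) = q(i/M) if M divides i and q̃(i) = 0 otherwise. Then q̃ is a probability distribution with H(q̃) = H(q) and H(p⋆q̃) = H(p) + H(q̃); in particular, the point (H(p)+H(q), H(p), H(q)) lies in the set 𝓗 = {(H(μ⋆ν), H(μ), H(ν)) : μ, ν probability distributions on ℤ}. -/

import Mathlib

/-- `p` is a probability distribution on `ℤ`. -/
def IsPMF (p : ℤ → ℝ) : Prop := (∀ k, 0 ≤ p k) ∧ HasSum p 1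

/-- Convolution of two distributions on `ℤ`. -/
noncomputable def conv (p q : ℤ → ℝ) : ℤ → ℝ := fun k => ∑' j, p j * q (k - j)

/-- Shannon entropy (in bits) of a distribution on `ℤ`. -/
noncomputable def entH (p : ℤ → ℝ) : ℝ := ∑' k, -(p k * Real.logb 2 (p k))

/-- The entropy set `𝓗 = {(H(μ⋆ν), H(μ), H(ν)) : μ, ν probability distributions on ℤ}`. -/
def entropySet : Set (ℝ × ℝ × ℝ) :=
  {v | ∃ μ ν : ℤ → ℝ, IsPMF μ ∧ IsPMF ν ∧ v = (entH (conv μ ν), entH μ, entH ν)}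

/-- if `p` is supported on `{0,…,M−1}`, `q` is supported on `{0,…,N−1}`,
and `q̃(i) = q(i/M)` for `M ∣ i` (and `0` otherwise), then `q̃` is a probability distribution
with `H(q̃) = H(q)` and `H(p⋆q̃) = H(p) + H(q̃)`; in particular
`(H(p)+H(q), H(p), H(q)) ∈ 𝓗`. -/
theorem stmt19 (M N : ℕ) (hM : 0 < M) (hN : 0 < N) (p q : ℤ → ℝ)
    (hp : IsPMF p) (hq : IsPMF q)
    (hsupp_p : ∀ k : ℤ, p k ≠ 0 → 0 ≤ k ∧ k < (M : ℤ))
    (hsupp_q : ∀ k : ℤ, q k ≠ 0 → 0 ≤ k ∧ k < (N : ℤ))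
    (qt : ℤ → ℝ)
    (hqt : ∀ i : ℤ, qt i = if (M : ℤ) ∣ i then q (i / (M : ℤ)) else 0) :
    IsPMF qt ∧ entH qt = entH q ∧ entH (conv p qt) = entH p + entH qt ∧
    (entH p + entH q, entH p, entH q) ∈ entropySet := by
  have hM' : (M : ℤ) ≠ 0 := by exact_mod_cast hM.ne'
  have hMp : (0 : ℤ) < M := by exact_mod_cast hM
  have : NeZero M := ⟨hM.ne'⟩
  have hinj : Function.Injective (fun j : ℤ => (M : ℤ) * j) := by
    intro a b h
    exact mul_left_cancel₀ hM' h
  have hqtM : ∀ j : ℤ, qt ((M : ℤ) * j) = q j := by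
    intro j
    rw [hqt, if_pos (dvd_mul_right _ _), Int.mul_ediv_cancel_left _ hM']
  have hout : ∀ x, x ∉ Set.range (fun j : ℤ => (M : ℤ) * j) → qt x = 0 := by
    intro x hx
    rw [hqt, if_neg]
    rintro ⟨c, rfl⟩
    exact hx ⟨c, rfl⟩
  have h1 : IsPMF qt := by
    refine ⟨fun k => ?_, ?_⟩
    · rw [hqt]
      split_ifs
      · exact hq.1 _
      · exact le_rfl
    · rw [← hinj.hasSum_iff hout]
      have : qt ∘ (fun j : ℤ => (M : ℤ) * j) = q := funext hqtM
      rw [this]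
      exact hq.2
  have h2 : entH qt = entH q := by
    unfold entH
    rw [← hinj.tsum_eq (f := fun k => -(qt k * Real.logb 2 (qt k)))]
    · simp only [hqtM]
    · intro x hx
      by_contra hc
      exact hx (by simp [hout x hc])
  have hconv : ∀ (a : ℤ) (b : Fin M), conv p qt (a * M + (b : ℕ)) = p ((b : ℕ) : ℤ) * q a := by
    intro a b
    have hb : ((b : ℕ) : ℤ) < M := by exact_mod_cast b.2
    have hb0 : (0 : ℤ) ≤ ((b : ℕ) : ℤ) := by positivity
    unfold conv
    rw [tsum_eq_single ((b : ℕ) : ℤ)]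
    · rw [add_sub_cancel_right, mul_comm a, hqtM]
    · intro j hj
      by_cases hpj : p j = 0
      · simp [hpj]
      obtain ⟨hj0, hj1⟩ := hsupp_p j hpj
      rw [hqt, if_neg, mul_zero]
      intro hd
      apply hj
      have hd2 : (M : ℤ) ∣ ((b : ℕ) : ℤ) - j := by
        have := dvd_sub hd (Dvd.intro_left a rfl : (M : ℤ) ∣ a * M)
        rwa [show a * (M : ℤ) + ((b : ℕ) : ℤ) - j - a * M = ((b : ℕ) : ℤ) - j by ring] at this
      have := Int.eq_zero_of_abs_lt_dvd hd2 (by rw [abs_lt]; constructor <;> linarith)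
      linarith
  have hpsum : ∀ f : ℤ → ℝ, (∀ k, p k = 0 → f k = 0) → ∑' k, f k = ∑ b : Fin M, f ((b : ℕ) : ℤ) := by
    intro f hf
    have hi : Function.Injective (fun b : Fin M => ((b : ℕ) : ℤ)) := by
      intro a b h
      have h2 : ((a : ℕ) : ℤ) = ((b : ℕ) : ℤ) := h
      exact Fin.ext (by exact_mod_cast h2)
    rw [← hi.tsum_eq (f := f), tsum_fintype]
    intro x hx
    obtain ⟨h0, h1⟩ := hsupp_p x (fun h => hx (hf x h))
    exact ⟨⟨x.toNat, by omega⟩, by simp [h0]⟩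
  have hqs : ∀ f : ℤ → ℝ, (∀ k, q k = 0 → f k = 0) → Summable f := by
    intro f hf
    apply summable_of_ne_finset_zero (s := Finset.Ico 0 (N : ℤ))
    intro b hb
    apply hf
    by_contra hc
    exact hb (by simpa using hsupp_q b hc)
  have hmul : ∀ x y : ℝ, -(x * y * Real.logb 2 (x * y)) =
      -(x * Real.logb 2 x) * y + x * -(y * Real.logb 2 y) := by
    intro x y
    by_cases hx : x = 0
    · simp [hx]
    by_cases hy : y = 0
    · simp [hy]
    rw [Real.logb_mul hx hy]
    ring
  have h3 : entH (conv p qt) = entH p + entH qt := by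
    rw [h2]
    have e1 : entH (conv p qt) = ∑' x : ℤ × Fin M,
        -(p ((x.2 : ℕ) : ℤ) * q x.1 * Real.logb 2 (p ((x.2 : ℕ) : ℤ) * q x.1)) := by
      unfold entH
      rw [← (Int.divModEquiv M).symm.tsum_eq]
      refine tsum_congr fun x => ?_
      have : (Int.divModEquiv M).symm x = x.1 * M + ((x.2 : ℕ) : ℤ) := rfl
      rw [this, hconv]
    have hs : Summable (fun x : ℤ × Fin M =>
        -(p ((x.2 : ℕ) : ℤ) * q x.1 * Real.logb 2 (p ((x.2 : ℕ) : ℤ) * q x.1))) := by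
      apply summable_of_ne_finset_zero (s := Finset.Ico 0 (N : ℤ) ×ˢ Finset.univ)
      intro b hb
      have : q b.1 = 0 := by
        by_contra hc
        exact hb (by simpa using hsupp_q b.1 hc)
      simp [this]
    have hp1 : ∑ b : Fin M, p ((b : ℕ) : ℤ) = 1 := by
      rw [← hpsum p (fun _ h => h)]
      exact hp.2.tsum_eq
    have hpH : ∑ b : Fin M, -(p ((b : ℕ) : ℤ) * Real.logb 2 (p ((b : ℕ) : ℤ))) = entH p := by
      unfold entH
      rw [hpsum _ (fun k h => by simp [h])]
    rw [e1, hs.tsum_prod]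
    have e2 : ∀ a : ℤ, ∑' b : Fin M,
        -(p ((b : ℕ) : ℤ) * q a * Real.logb 2 (p ((b : ℕ) : ℤ) * q a)) =
        entH p * q a + -(q a * Real.logb 2 (q a)) := by
      intro a
      rw [tsum_fintype]
      simp only [hmul]
      rw [Finset.sum_add_distrib, ← Finset.sum_mul, ← Finset.sum_mul, hpH, hp1, one_mul]
    simp only [e2]
    rw [Summable.tsum_add (hq.2.summable.mul_left _) (hqs _ (fun k h => by simp [h])),
      tsum_mul_left, hq.2.tsum_eq, mul_one]
    rfl
  refine ⟨h1, h2, h3, p, qt, hp, h1, ?_⟩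
  rw [h3, h2]
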